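/- Let λ, λ₁, λ₂ > 0 and 0 ≤ r < 1. Then ∫₀¹∫₀¹ u₁u₂ [1 - r(1-u₁^{1/λ₁})(1-u₂^{1/λ₂})]^{-λ} du₁ du₂ = (1/4)·₃F₂(1,1,λ; 2λ₁+1, 2λ₂+1; r), where ₃F₂(a₁,a₂,a₃;b₁,b₂;z) = Σ_{k≥0} (a₁)_k(a₂)_k(a₃)_k/((b₁)_k(b₂)_k) · z^k/k!. -/

import Mathlib

open MeasureTheory Real Set

noncomputable def poch (a : ℝ) (n : ℕ) : ℝ := (ascPochhammer ℝ n).eval a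

/-- The generalized hypergeometric function `₃F₂(a₁,a₂,a₃;b₁,b₂;z)`. -/
noncomputable def F32 (a₁ a₂ a₃ b₁ b₂ z : ℝ) : ℝ :=
  ∑' k : ℕ, (poch a₁ k * poch a₂ k * poch a₃ k) / (poch b₁ k * poch b₂ k) *
    z ^ k / k.factorial

theorem poch_succ (a : ℝ) (n : ℕ) : poch a (n + 1) = poch a n * (a + n) :=
  ascPochhammer_succ_eval n a

theorem poch_pos {a : ℝ} (ha : 0 < a) (n : ℕ) : 0 < poch a n :=
  ascPochhammer_pos n a ha

theorem ring_choose_add_sub_one (a : ℝ) (n : ℕ) :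
    Ring.choose (a + n - 1) n = poch a n / n.factorial := by
  have h := Ring.factorial_nsmul_multichoose_eq_ascPochhammer a n
  rw [Polynomial.ascPochhammer_smeval_eq_eval, nsmul_eq_mul] at h
  rw [eq_div_iff (by positivity), poch, ← h, Ring.choose,
    show a + n - 1 - n + 1 = a by ring, mul_comm]

/-- The binomial series of `(1 - x) ^ (-a)`. -/
theorem hasSum_one_sub_rpow_neg (a : ℝ) {x : ℝ} (hx0 : 0 ≤ x) (hx1 : x < 1) :
    HasSum (fun k : ℕ ↦ poch a k / k.factorial * x ^ k) ((1 - x) ^ (-a)) := by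
  have hx : x ∈ Metric.eball (0 : ℝ) 1 := by
    rw [Metric.mem_eball, edist_zero_right, enorm_eq_nnnorm]
    have : ‖x‖ < 1 := by rwa [Real.norm_of_nonneg hx0]
    exact_mod_cast this
  have h := (one_div_one_sub_rpow_hasFPowerSeriesOnBall_zero a).hasSum hx
  simp only [FormalMultilinearSeries.ofScalars_apply_eq, zero_add, smul_eq_mul,
    ring_choose_add_sub_one] at h
  rwa [rpow_neg (by linarith), ← one_div]

theorem continuous_one_sub_rpow {p : ℝ} (hp : 0 < p) : Continuous fun u : ℝ ↦ 1 - u ^ p :=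
  continuous_const.sub (Real.continuous_rpow_const hp.le)

theorem one_sub_rpow_mem_Icc {p u : ℝ} (hp : 0 < p) (hu : u ∈ Ioc (0 : ℝ) 1) :
    1 - u ^ p ∈ Icc (0 : ℝ) 1 :=
  ⟨sub_nonneg.2 (rpow_le_one hu.1.le hu.2 hp.le), sub_le_self _ (rpow_nonneg hu.1.le _)⟩

theorem integral_mul_one_sub_rpow_pow_succ {p : ℝ} (hp : 0 < p) (k : ℕ) :
    (2 + (k + 1) * p) * ∫ u in (0 : ℝ)..1, u * (1 - u ^ p) ^ (k + 1) =
      (k + 1) * p * ∫ u in (0 : ℝ)..1, u * (1 - u ^ p) ^ k := by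
  have hc := continuous_one_sub_rpow hp
  have hi (m : ℕ) : IntervalIntegrable (fun u : ℝ ↦ u * (1 - u ^ p) ^ m) volume 0 1 :=
    (continuous_id.mul (hc.pow m)).intervalIntegrable 0 1
  have h := intervalIntegral.integral_eq_sub_of_hasDerivAt_of_le zero_le_one
    (f := fun u : ℝ ↦ u ^ 2 * (1 - u ^ p) ^ (k + 1))
    (f' := fun u : ℝ ↦ (2 + (k + 1) * p) * (u * (1 - u ^ p) ^ (k + 1)) -
      (k + 1) * p * (u * (1 - u ^ p) ^ k))
    ((continuous_pow 2).mul (hc.pow _)).continuousOn ?_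
    (((hi _).const_mul _).sub ((hi _).const_mul _))
  · rw [intervalIntegral.integral_sub ((hi _).const_mul _) ((hi _).const_mul _),
      intervalIntegral.integral_const_mul, intervalIntegral.integral_const_mul] at h
    simpa [sub_eq_zero] using h
  · intro u hu
    have hd := (hasDerivAt_pow 2 u).mul
      (((hasDerivAt_rpow_const (p := p) (Or.inl hu.1.ne')).const_sub 1).pow (k + 1))
    refine hd.congr_deriv ?_
    have hu' : u ^ p = u * u ^ (p - 1) := by
      rw [rpow_sub_one hu.1.ne']
      field_simp [hu.1.ne']
    simp only [Nat.add_sub_cancel, Nat.cast_add, Nat.cast_one, Nat.cast_ofNat, Pi.pow_apply,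
      pow_succ _ k]
    linear_combination ((k + 1) * p * u * (1 - u ^ p) ^ k) * hu'

theorem integral_mul_one_sub_rpow_pow {l : ℝ} (hl : 0 < l) (k : ℕ) :
    ∫ u in (0 : ℝ)..1, u * (1 - u ^ (1 / l)) ^ k = poch 1 k / (2 * poch (2 * l + 1) k) := by
  induction k with
  | zero => simp [poch]
  | succ k ih =>
    have h := integral_mul_one_sub_rpow_pow_succ (one_div_pos.2 hl) k
    have hpos := poch_pos (show 0 < 2 * l + 1 by positivity) k
    rw [ih] at h
    rw [poch_succ, poch_succ]
    field_simp at h ⊢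
    linear_combination h

/-- Termwise integration over `[0, 1]` of a power series in a function with values in `[0, 1]`. -/
theorem hasSum_integral_mul_pow {c : ℕ → ℝ} {g F : ℝ → ℝ} (hc : Summable c)
    (hg : Continuous g) (hg01 : ∀ u ∈ Ioc (0 : ℝ) 1, g u ∈ Icc (0 : ℝ) 1)
    (hF : ∀ u ∈ Ioc (0 : ℝ) 1, HasSum (fun k ↦ c k * (u * g u ^ k)) (F u)) :
    HasSum (fun k ↦ c k * ∫ u in (0 : ℝ)..1, u * g u ^ k) (∫ u in (0 : ℝ)..1, F u) := by
  simp only [← intervalIntegral.integral_const_mul]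
  refine intervalIntegral.hasSum_integral_of_dominated_convergence (fun k _ ↦ ‖c k‖)
    (fun k ↦ (continuous_const.mul (continuous_id.mul (hg.pow k))).aestronglyMeasurable)
    (fun k ↦ .of_forall fun u hu ↦ ?_) (.of_forall fun _ _ ↦ hc.norm)
    intervalIntegrable_const (.of_forall fun u hu ↦ ?_)
  all_goals rw [uIoc_of_le zero_le_one] at hu
  · obtain ⟨h0, h1⟩ := hg01 u hu
    rw [norm_mul, Real.norm_of_nonneg (mul_nonneg hu.1.le (pow_nonneg h0 k))]
    exact mul_le_of_le_one_right (norm_nonneg _)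
      (mul_le_one₀ hu.2 (pow_nonneg h0 k) (pow_le_one₀ h0 h1))
  · exact hF u hu

theorem copula_double_integral (lam lam₁ lam₂ r : ℝ)
    (hlam : 0 < lam) (hlam₁ : 0 < lam₁) (hlam₂ : 0 < lam₂)
    (hr0 : 0 ≤ r) (hr1 : r < 1) :
    (∫ u₁ in (0:ℝ)..1, ∫ u₂ in (0:ℝ)..1,
        u₁ * u₂ * (1 - r * (1 - u₁ ^ (1 / lam₁)) * (1 - u₂ ^ (1 / lam₂))) ^ (-lam)) =
      (1 / 4) * F32 1 1 lam (2 * lam₁ + 1) (2 * lam₂ + 1) r := by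
  have hp₁ := one_div_pos.2 hlam₁
  have hp₂ := one_div_pos.2 hlam₂
  have hbin {s u : ℝ} (hs : 0 ≤ s) (hs1 : s < 1) (hu : u ∈ Ioc (0 : ℝ) 1) :
      HasSum (fun k : ℕ ↦ poch lam k / k.factorial * s ^ k * (u * (1 - u ^ (1 / lam₂)) ^ k))
        (u * (1 - s * (1 - u ^ (1 / lam₂))) ^ (-lam)) := by
    obtain ⟨h0, h1⟩ := one_sub_rpow_mem_Icc hp₂ hu
    convert! (hasSum_one_sub_rpow_neg lam (mul_nonneg hs h0)
      ((mul_le_of_le_one_right hs h1).trans_lt hs1)).mul_left u using 2 with k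
    rw [mul_pow]
    ring
  have inner {s : ℝ} (hs : 0 ≤ s) (hs1 : s < 1) :=
    hasSum_integral_mul_pow (hasSum_one_sub_rpow_neg lam hs hs1).summable
      (continuous_one_sub_rpow hp₂) (fun _ ↦ one_sub_rpow_mem_Icc hp₂)
      fun _ ↦ hbin hs hs1
  have outer := hasSum_integral_mul_pow (inner hr0 hr1).summable
    (continuous_one_sub_rpow hp₁) (fun _ ↦ one_sub_rpow_mem_Icc hp₁)
    (F := fun u₁ ↦ ∫ u₂ in (0:ℝ)..1,
      u₁ * u₂ * (1 - r * (1 - u₁ ^ (1 / lam₁)) * (1 - u₂ ^ (1 / lam₂))) ^ (-lam))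
    fun u hu ↦ by
      obtain ⟨h0, h1⟩ := one_sub_rpow_mem_Icc hp₁ hu
      simp only [mul_assoc u, intervalIntegral.integral_const_mul]
      convert! (inner (mul_nonneg hr0 h0)
        ((mul_le_of_le_one_right hr0 h1).trans_lt hr1)).mul_left u using 2 with k
      rw [mul_pow]
      ring
  rw [← outer.tsum_eq, F32, ← tsum_mul_left]
  refine tsum_congr fun k ↦ ?_
  rw [integral_mul_one_sub_rpow_pow hlam₁, integral_mul_one_sub_rpow_pow hlam₂]
  have h₁ := poch_pos (show 0 < 2 * lam₁ + 1 by positivity) k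
  have h₂ := poch_pos (show 0 < 2 * lam₂ + 1 by positivity) k
  field_simp
  ring
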